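/- Let X be a shift space, φ : X → ℝ strictly positive and continuous, and Z ⊂ X arbitrary. Then the Hausdorff dimension of Z with respect to the metric d_φ is the unique solution s of the Bowen equation P_Z(−sφ) = 0; that is, dim_φ(Z) = inf{s : P_Z(−sφ) ≤ 0} and P_Z(−dim_φ(Z)·φ) = 0. -/

import Mathlib

open MeasureTheory Filter Topology Set
open scoped ENNReal Classical

namespace Paper

variable {A : Type} [Fintype A] [DecidableEq A] [TopologicalSpace A] [DiscreteTopology A]
  [MeasurableSpace A] [BorelSpace A]

/-- The left shift map on the full shift `A^ℕ`. -/
def shift : (ℕ → A) → (ℕ → A) := fun x i => x (i + 1)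

/-- The cylinder set of a finite word `w`: points whose initial word is `w`. -/
def cylinder (w : List A) : Set (ℕ → A) := {x | ∀ i : Fin w.length, x i = w.get i}

/-- The language of `X`: finite words `w` with `[w] ∩ X ≠ ∅`. -/
def language (X : Set (ℕ → A)) : Set (List A) := {w | (cylinder w ∩ X).Nonempty}

/-- One edit of a word: a substitution, an insertion, or a deletion. -/
def EditStep (w w' : List A) : Prop :=
  (∃ u₁ u₂ : List A, ∃ a a' : A, w = u₁ ++ [a] ++ u₂ ∧ w' = u₁ ++ [a'] ++ u₂) ∨
  (∃ u₁ u₂ : List A, ∃ a' : A, w = u₁ ++ u₂ ∧ w' = u₁ ++ [a'] ++ u₂) ∨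
  (∃ u₁ u₂ : List A, ∃ a : A, w = u₁ ++ [a] ++ u₂ ∧ w' = u₁ ++ u₂)

/-- The edit distance: the minimal number of edits transforming `v` into `w`. -/
noncomputable def editDist (v w : List A) : ℕ :=
  sInf {n | ∃ f : ℕ → List A, f 0 = v ∧ f n = w ∧ ∀ i < n, EditStep (f i) (f (i + 1))}

/-- `G ⊆ L` has (W)-specification (with some gap length `τ`). -/
def HasSpecW (L G : Set (List A)) : Prop :=
  ∃ τ : ℕ, ∀ v ∈ G, ∀ w ∈ G, ∃ u ∈ L, u.length ≤ τ ∧ v ++ u ++ w ∈ G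

/-- A mistake function: nondecreasing with `g n / n → 0`. -/
def MistakeFun (g : ℕ → ℕ) : Prop :=
  Monotone g ∧ Tendsto (fun n => (g n : ℝ) / n) atTop (𝓝 0)

/-- `L` is edit approachable by `G`. -/
def EditApproachable (L G : Set (List A)) : Prop :=
  ∃ g : ℕ → ℕ, MistakeFun g ∧ ∀ w ∈ L, ∃ v ∈ G, editDist v w ≤ g w.length

/-- The shift map restricted to a (shift-invariant) subset `X`, as a self-map of `↥X`. -/
noncomputable def subShift (X : Set (ℕ → A)) : ↥X → ↥X := fun x =>
  if h : shift x.val ∈ X then ⟨shift x.val, h⟩ else x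

/-- Birkhoff sum `S_n φ = ∑_{i<n} φ ∘ σ^i`. -/
def birkhoff {Y : Type*} (σ : Y → Y) (φ : Y → ℝ) (n : ℕ) (y : Y) : ℝ :=
  ∑ i ∈ Finset.range n, φ (σ^[i] y)

/-- The Birkhoff average `(1/n) S_n φ`. -/
noncomputable def birkAvg {Y : Type*} (σ : Y → Y) (φ : Y → ℝ) (n : ℕ) (y : Y) : ℝ :=
  (n : ℝ)⁻¹ * birkhoff σ φ n y

/-- Carathéodory sum `M(Z,t,φ,N)` over covers of `Z` by cylinders of length `> N`. -/
noncomputable def Mcal (X : Set (ℕ → A)) (φ : ↥X → ℝ) (Z : Set ↥X) (t : ℝ) (N : ℕ) : ℝ≥0∞ :=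
  ⨅ (S : Set (List A)) (_ : S.Countable) (_ : ∀ w ∈ S, N < w.length)
    (_ : Z ⊆ ⋃ w ∈ S, Subtype.val ⁻¹' cylinder w),
    ∑' w : S, ENNReal.ofReal (Real.exp (-t * (w : List A).length +
      sSup (birkhoff (subShift X) φ (w : List A).length ''
        (Subtype.val ⁻¹' cylinder (w : List A)))))

/-- `M(Z,t,φ) = lim_{N→∞} M(Z,t,φ,N)` (the limit of a nondecreasing quantity). -/
noncomputable def McalLim (X : Set (ℕ → A)) (φ : ↥X → ℝ) (Z : Set ↥X) (t : ℝ) : ℝ≥0∞ :=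
  ⨆ N : ℕ, Mcal X φ Z t N

/-- The topological pressure `P_Z(φ)` of `Z ⊆ X`. -/
noncomputable def pressure (X : Set (ℕ → A)) (φ : ↥X → ℝ) (Z : Set ↥X) : ℝ :=
  sInf {t : ℝ | McalLim X φ Z t = 0}

/-- The empirical measure `ℰ_n(x) = (1/n) ∑_{i<n} δ_{σ^i x}`. -/
noncomputable def empiric {Y : Type*} [MeasurableSpace Y] (σ : Y → Y) (n : ℕ) (x : Y) :
    Measure Y := (n : ℝ≥0∞)⁻¹ • ∑ i ∈ Finset.range n, Measure.dirac (σ^[i] x)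

/-- The set `A(ℰ_n(x))` of weak* limit points of the sequence of empirical measures of `x`:
probability measures that are limits of the empirical measures along a subsequence. -/
def limitPts {Y : Type*} [MeasurableSpace Y] [TopologicalSpace Y] (σ : Y → Y) (x : Y) :
    Set (ProbabilityMeasure Y) :=
  {μ | ∃ φ : ℕ → ℕ, StrictMono φ ∧ ∀ f : C(Y, ℝ),
      Tendsto (fun k => birkAvg σ (fun y => f y) (φ k) x) atTop (𝓝 (∫ y, f y ∂μ.toMeasure))}

/-- The saturated set `G_K = {x : A(ℰ_n(x)) = K}`. -/
def saturated {Y : Type*} [MeasurableSpace Y] [TopologicalSpace Y] (σ : Y → Y)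
    (K : Set (ProbabilityMeasure Y)) : Set Y := {x | limitPts σ x = K}

/-- The generic points of `μ`: those `x` with `ℰ_n(x) → μ` in the weak* topology. -/
def genericPts {Y : Type*} [MeasurableSpace Y] [TopologicalSpace Y] (σ : Y → Y)
    (μ : ProbabilityMeasure Y) : Set Y :=
  {x | ∀ f : C(Y, ℝ),
      Tendsto (fun n => birkAvg σ (fun y => f y) n x) atTop (𝓝 (∫ y, f y ∂μ.toMeasure))}

/-- `μ` is a `σ`-invariant (probability) measure. -/
def IsInvariant {Y : Type*} [MeasurableSpace Y] (σ : Y → Y) (μ : ProbabilityMeasure Y) : Prop :=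
  μ.toMeasure.map σ = μ.toMeasure

/-- The level set `X(ψ,α)` of points whose Birkhoff averages of `ψ` converge to `α`. -/
def levelSet {Y : Type*} (σ : Y → Y) (ψ : Y → ℝ) (α : ℝ) : Set Y :=
  {x | Tendsto (fun n => birkAvg σ ψ n x) atTop (𝓝 α)}

/-- The irregular set `X̂(ψ)` of points whose Birkhoff averages of `ψ` do not converge. -/
def irregular {Y : Type*} (σ : Y → Y) (ψ : Y → ℝ) : Set Y :=
  {x | ¬ ∃ α : ℝ, Tendsto (fun n => birkAvg σ ψ n x) atTop (𝓝 α)}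

/-- The cylinder of a word of length `n` given as `w : Fin n → A`. -/
def cylF {n : ℕ} (w : Fin n → A) : Set (ℕ → A) := {x | ∀ i : Fin n, x i = w i}

/-- The entropy `H_n(μ)` of the partition of `X` into cylinders of length `n`. -/
noncomputable def wordEntropy (X : Set (ℕ → A)) (μ : ProbabilityMeasure ↥X) (n : ℕ) : ℝ :=
  ∑ w : Fin n → A, Real.negMulLog ((μ.toMeasure (Subtype.val ⁻¹' cylF w)).toReal)

/-- The measure-theoretic (Kolmogorov–Sinai) entropy `h_μ(σ)` of a shift-invariant measure on a
subshift: by subadditivity, `lim_n H_n/n = inf_{n ≥ 1} H_n/n`. -/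
noncomputable def entropy (X : Set (ℕ → A)) (μ : ProbabilityMeasure ↥X) : ℝ :=
  ⨅ n : ℕ, wordEntropy X μ (n + 1) / (n + 1)

/-- The distance `D` on measures induced by a countable family of continuous functions. -/
noncomputable def Dmetric {Y : Type*} [MeasurableSpace Y] [TopologicalSpace Y]
    (f : ℕ → C(Y, ℝ)) (μ ν : Measure Y) : ℝ :=
  ∑' k : ℕ, ((2 : ℝ) ^ (k + 1))⁻¹ * |(∫ y, f k y ∂μ) - ∫ y, f k y ∂ν|

/-- The family `f` is separating: `D` separates Borel probability measures. -/
def Separating {Y : Type*} [MeasurableSpace Y] [TopologicalSpace Y] (f : ℕ → C(Y, ℝ)) : Prop :=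
  ∀ μ ν : ProbabilityMeasure Y,
    (∀ k, (∫ y, f k y ∂μ.toMeasure) = ∫ y, f k y ∂ν.toMeasure) → μ = ν

/-- Diameter of a set with respect to a distance function `d`, valued in `ℝ≥0∞`. -/
noncomputable def ediam {Y : Type*} (d : Y → Y → ℝ) (U : Set Y) : ℝ≥0∞ :=
  ⨆ x ∈ U, ⨆ y ∈ U, ENNReal.ofReal (d x y)

/-- The `s`-dimensional Hausdorff pre-measure at scale `ε` w.r.t. the distance `d`. -/
noncomputable def hMeasAux {Y : Type*} (d : Y → Y → ℝ) (s : ℝ) (ε : ℝ≥0∞) (Z : Set Y) : ℝ≥0∞ :=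
  ⨅ (C : ℕ → Set Y) (_ : Z ⊆ ⋃ n, C n) (_ : ∀ n, ediam d (C n) ≤ ε),
    ∑' n, ⨆ (_ : (C n).Nonempty), ediam d (C n) ^ s

/-- The `s`-dimensional Hausdorff measure w.r.t. the distance `d`. -/
noncomputable def hMeas {Y : Type*} (d : Y → Y → ℝ) (s : ℝ) (Z : Set Y) : ℝ≥0∞ :=
  ⨆ (ε : ℝ≥0∞) (_ : 0 < ε), hMeasAux d s ε Z

/-- The Hausdorff dimension of `Z` w.r.t. the distance `d`. -/
noncomputable def hdim {Y : Type*} (d : Y → Y → ℝ) (Z : Set Y) : ℝ :=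
  sInf {s : ℝ | 0 ≤ s ∧ hMeas d s Z = 0}

/-- The length `|x ∧ y|` of the longest common prefix of two distinct points. -/
noncomputable def wedge (x y : ℕ → A) : ℕ := sInf {n | x n ≠ y n}

/-- The Gatzouras–Peres distance `d_φ` associated with a strictly positive continuous `φ`. -/
noncomputable def dphi (X : Set (ℕ → A)) (φ : ↥X → ℝ) (x y : ↥X) : ℝ :=
  if x = y then 0
  else Real.exp (-(sSup (birkhoff (subShift X) φ (wedge x.val y.val) ''
      {z : ↥X | ∀ i < wedge x.val y.val, z.val i = x.val i})))

/-- The word `w` occurs in `x` at position `k`. -/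
def occursAt (w : List A) (x : ℕ → A) (k : ℕ) : Prop :=
  ∀ i : Fin w.length, x (k + i) = w.get i

/-- A shift of finite type: determined by a finite set of forbidden words. -/
def IsSFT {B : Type} (Z : Set (ℕ → B)) : Prop :=
  ∃ F : Set (List B), F.Finite ∧ Z = {x | ∀ w ∈ F, ∀ k, ¬ occursAt w x k}

/-- A sofic shift: the image of a shift of finite type under a sliding block code. -/
def IsSofic (Y : Set (ℕ → A)) : Prop :=
  ∃ (B : Type) (_ : Fintype B) (Z : Set (ℕ → B)) (π : (ℕ → B) → (ℕ → A)),
    IsSFT Z ∧ Set.MapsTo shift Z Z ∧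
    (∃ r : ℕ, ∀ z ∈ Z, ∀ z' ∈ Z, ∀ k, (∀ i ≤ k + r, z i = z' i) → π z k = π z' k) ∧
    (∀ z ∈ Z, π (shift z) = shift (π z)) ∧ π '' Z = Y

/-- Topological transitivity of a subshift, via its language. -/
def IsTransitive (Y : Set (ℕ → A)) : Prop :=
  ∀ u ∈ language Y, ∀ v ∈ language Y, ∃ w : List A, u ++ w ++ v ∈ language Y

/-- The prefix of length `n` of `x`, as a word. -/
def prefixWord (x : ℕ → A) (n : ℕ) : List A := List.ofFn fun i : Fin n => x i

/-- The norm `‖m‖ = sup_{0 < ‖f‖ ≤ 1} |∫ f dm| / ‖f‖` of a measure on a compact space. -/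
noncomputable def mnorm {Y : Type*} [TopologicalSpace Y] [CompactSpace Y] [MeasurableSpace Y]
    (m : Measure Y) : ℝ :=
  sSup ((fun f : C(Y, ℝ) => |∫ y, f y ∂m| / ‖f‖) '' {f : C(Y, ℝ) | 0 < ‖f‖ ∧ ‖f‖ ≤ 1})

/-- Strict lexicographic order on `ℕ`-indexed sequences of naturals. -/
def lexLt (x y : ℕ → ℕ) : Prop := ∃ n : ℕ, (∀ i < n, x i = y i) ∧ x n < y n

/-- The β-shift: all sequences over `{0, …, b-1}` all of whose shifts are lexicographically
below the expansion `w` of `1` in base `β` (where `b = ⌈β⌉`). -/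
def betaShift (b : ℕ) (w : ℕ → ℕ) : Set (ℕ → Fin b) :=
  {x | ∀ j : ℕ, 1 ≤ j → lexLt (fun i => ((shift^[j] x) i : ℕ)) w}

/-- The S-gap shift: sequences over `{0,1}` such that the number of `0`s between any two
consecutive `1`s lies in `S`. -/
def sGapShift (S : Set ℕ) : Set (ℕ → Fin 2) :=
  {x | ∀ k l : ℕ, k < l → x k = 1 → x l = 1 →
    (∀ m : ℕ, k < m → m < l → x m = 0) → l - k - 1 ∈ S}


set_option linter.unusedSectionVars false

/-- Every term of a family indexed by the range of `g` is hit, so summing over the range costs no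
more than summing over the index type. -/
theorem tsum_range_le {ι β : Type*} (g : ι → β) (f : β → ℝ≥0∞) :
    ∑' b : Set.range g, f b ≤ ∑' i, f (g i) := by
  have h := ENNReal.tsum_comp_le_tsum_of_injective
    (Set.rangeSplitting_injective g) (fun i => f (g i))
  simpa only [Set.apply_rangeSplitting] using h

theorem mem_cylinder_iff {w : List A} {x : ℕ → A} :
    x ∈ cylinder w ↔ ∀ i (h : i < w.length), x i = w[i] :=
  ⟨fun hx i h => hx ⟨i, h⟩, fun hx i => hx i i.2⟩

@[simp] theorem length_prefixWord (x : ℕ → A) (n : ℕ) : (prefixWord x n).length = n := by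
  simp [prefixWord]

theorem mem_cylinder_prefixWord {x y : ℕ → A} {n : ℕ} :
    y ∈ cylinder (prefixWord x n) ↔ ∀ i < n, y i = x i := by
  simp [mem_cylinder_iff, prefixWord]

theorem eq_of_mem_cylinder {w : List A} {x y : ℕ → A} (hx : x ∈ cylinder w)
    (hy : y ∈ cylinder w) {i : ℕ} (hi : i < w.length) : y i = x i := by
  rw [mem_cylinder_iff] at hx hy
  rw [hx i hi, hy i hi]

theorem wedge_spec {x y : ℕ → A} (h : x ≠ y) :
    x (wedge x y) ≠ y (wedge x y) :=
  Nat.sInf_mem (s := {n | x n ≠ y n}) (Function.ne_iff.1 h)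

theorem eq_of_lt_wedge {x y : ℕ → A} {i : ℕ} (h : i < wedge x y) : x i = y i := by
  by_contra hne
  exact Nat.notMem_of_lt_sInf h hne

theorem subShift_iterate_apply {X : Set (ℕ → A)} (hX : Set.MapsTo shift X X) (i : ℕ) (x : ↥X)
    (j : ℕ) : ((subShift X)^[i] x).val j = x.val (j + i) := by
  induction i generalizing x with
  | zero => rfl
  | succ i ih =>
    rw [Function.iterate_succ_apply, ih, subShift, dif_pos (hX x.2)]
    change x.val (j + i + 1) = _
    rw [add_assoc]

section Birkhoff

variable {Y : Type*} (σ : Y → Y) {ψ χ : Y → ℝ}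

theorem birkhoff_le {c : ℝ} (h : ∀ y, ψ y ≤ c) (n : ℕ) (y : Y) : birkhoff σ ψ n y ≤ n * c := by
  simpa [birkhoff] using Finset.sum_le_card_nsmul (Finset.range n) _ c fun i _ => h (σ^[i] y)

theorem le_birkhoff {c : ℝ} (h : ∀ y, c ≤ ψ y) (n : ℕ) (y : Y) : n * c ≤ birkhoff σ ψ n y := by
  simpa [birkhoff] using Finset.card_nsmul_le_sum (Finset.range n) _ c fun i _ => h (σ^[i] y)

theorem birkhoff_le_add {c : ℝ} (h : ∀ y, ψ y ≤ χ y + c) (n : ℕ) (y : Y) :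
    birkhoff σ ψ n y ≤ birkhoff σ χ n y + n * c := by
  refine (Finset.sum_le_sum fun i _ => h (σ^[i] y)).trans (le_of_eq ?_)
  simp [birkhoff, Finset.sum_add_distrib]

theorem birkhoff_mono_length (h : ∀ y, 0 ≤ ψ y) {n k : ℕ} (hnk : n ≤ k) (y : Y) :
    birkhoff σ ψ n y ≤ birkhoff σ ψ k y :=
  Finset.sum_le_sum_of_subset_of_nonneg (by simpa using hnk) fun i _ _ => h _

theorem birkhoff_const_mul (c : ℝ) (n : ℕ) (y : Y) :
    birkhoff σ (fun z => c * ψ z) n y = c * birkhoff σ ψ n y := by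
  simp [birkhoff, Finset.mul_sum]

theorem bddAbove_birkhoff {c : ℝ} (h : ∀ y, ψ y ≤ c) (n : ℕ) (S : Set Y) :
    BddAbove (birkhoff σ ψ n '' S) :=
  ⟨n * c, by rintro _ ⟨y, -, rfl⟩; exact birkhoff_le σ h n y⟩

end Birkhoff

/-- The contribution of the cylinder of `w` to the Carathéodory sum. -/
noncomputable def cylWeight (X : Set (ℕ → A)) (ψ : ↥X → ℝ) (t : ℝ) (w : List A) : ℝ≥0∞ :=
  ENNReal.ofReal (Real.exp (-t * w.length +
    sSup (birkhoff (subShift X) ψ w.length '' (Subtype.val ⁻¹' cylinder w))))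

section Caratheodory

variable {X : Set (ℕ → A)} {ψ χ : ↥X → ℝ} {Z : Set ↥X} {t : ℝ} {N : ℕ}

theorem Mcal_le {S : Set (List A)} (hS : S.Countable) (hN : ∀ w ∈ S, N < w.length)
    (hZ : Z ⊆ ⋃ w ∈ S, Subtype.val ⁻¹' cylinder w) :
    Mcal X ψ Z t N ≤ ∑' w : S, cylWeight X ψ t w :=
  iInf_le_of_le S <| iInf_le_of_le hS <| iInf_le_of_le hN <| iInf_le_of_le hZ le_rfl

theorem le_Mcal {c : ℝ≥0∞} (h : ∀ S : Set (List A), S.Countable → (∀ w ∈ S, N < w.length) →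
    (Z ⊆ ⋃ w ∈ S, Subtype.val ⁻¹' cylinder w) → c ≤ ∑' w : S, cylWeight X ψ t w) :
    c ≤ Mcal X ψ Z t N :=
  le_iInf fun S => le_iInf fun h₁ => le_iInf fun h₂ => le_iInf fun h₃ => h S h₁ h₂ h₃

theorem exists_of_Mcal_lt {c : ℝ≥0∞} (h : Mcal X ψ Z t N < c) :
    ∃ S : Set (List A), S.Countable ∧ (∀ w ∈ S, N < w.length) ∧
      (Z ⊆ ⋃ w ∈ S, Subtype.val ⁻¹' cylinder w) ∧ ∑' w : S, cylWeight X ψ t w < c := by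
  by_contra! hc
  exact h.not_ge (le_Mcal hc)

theorem McalLim_eq_zero_iff : McalLim X ψ Z t = 0 ↔ ∀ N, Mcal X ψ Z t N = 0 := by
  simp [McalLim]

/-- Only cylinders that meet `X` matter when comparing two Carathéodory sums. -/
theorem Mcal_mono_of_cylWeight_le {u : ℝ}
    (h : ∀ w : List A, (Subtype.val ⁻¹' cylinder w : Set ↥X).Nonempty →
      cylWeight X χ u w ≤ cylWeight X ψ t w) :
    Mcal X χ Z u N ≤ Mcal X ψ Z t N := by
  refine le_Mcal fun S hS hN hZ => ?_
  let S' := {w ∈ S | (Subtype.val ⁻¹' cylinder w : Set ↥X).Nonempty}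
  have hS' : S' ⊆ S := fun w hw => hw.1
  refine (Mcal_le (S := S') (hS.mono hS') (fun w hw => hN w hw.1) fun z hz => ?_).trans
    ((ENNReal.tsum_le_tsum fun w : S' => h w w.2.2).trans (ENNReal.tsum_mono_subtype _ hS'))
  obtain ⟨w, hw, hzw⟩ := mem_iUnion₂.1 (hZ hz)
  exact mem_iUnion₂.2 ⟨w, ⟨hw, ⟨z, hzw⟩⟩, hzw⟩

theorem cylWeight_le_of_le_add {c B : ℝ} (hB : ∀ x, ψ x ≤ B) (h : ∀ x, χ x ≤ ψ x + c)
    {w : List A} (hw : (Subtype.val ⁻¹' cylinder w : Set ↥X).Nonempty) :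
    cylWeight X χ (t + c) w ≤ cylWeight X ψ t w := by
  refine ENNReal.ofReal_le_ofReal (Real.exp_le_exp.2 ?_)
  have : sSup (birkhoff (subShift X) χ w.length '' (Subtype.val ⁻¹' cylinder w)) ≤
      sSup (birkhoff (subShift X) ψ w.length '' (Subtype.val ⁻¹' cylinder w)) + w.length * c := by
    refine csSup_le (hw.image _) ?_
    rintro _ ⟨y, hy, rfl⟩
    refine (birkhoff_le_add _ h _ y).trans ?_
    gcongr
    exact le_csSup (bddAbove_birkhoff _ hB _ _) (mem_image_of_mem _ hy)
  linarith

theorem McalLim_eq_zero_of_le_add {c B : ℝ} (hB : ∀ x, ψ x ≤ B) (h : ∀ x, χ x ≤ ψ x + c)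
    (ht : McalLim X ψ Z t = 0) : McalLim X χ Z (t + c) = 0 := by
  rw [McalLim_eq_zero_iff] at ht ⊢
  exact fun N => le_antisymm
    ((Mcal_mono_of_cylWeight_le fun w hw => cylWeight_le_of_le_add hB h hw).trans (ht N).le)
    zero_le

theorem le_of_McalLim_eq_zero {b B : ℝ} (hZ : Z.Nonempty) (hb : ∀ x, b ≤ ψ x)
    (hB : ∀ x, ψ x ≤ B) (ht : McalLim X ψ Z t = 0) : b ≤ t := by
  by_contra! hlt
  have h1 : 1 ≤ Mcal X ψ Z t 0 := by
    refine le_Mcal fun S _ _ hcov => ?_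
    obtain ⟨z, hz⟩ := hZ
    obtain ⟨w, hw, hzw⟩ := mem_iUnion₂.1 (hcov hz)
    refine le_trans ?_ (ENNReal.le_tsum (⟨w, hw⟩ : S))
    rw [cylWeight, ENNReal.one_le_ofReal, Real.one_le_exp_iff]
    have h2 := le_csSup (bddAbove_birkhoff (subShift X) hB w.length _)
      (mem_image_of_mem (birkhoff (subShift X) ψ w.length) hzw)
    have h3 := le_birkhoff (subShift X) hb w.length z
    have h4 : (0 : ℝ) ≤ w.length * (b - t) :=
      mul_nonneg (Nat.cast_nonneg _) (sub_nonneg.2 hlt.le)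
    dsimp only
    linarith
  rw [McalLim_eq_zero_iff.1 ht 0] at h1
  simp at h1

theorem exists_McalLim_eq_zero {B : ℝ} (hZ : Z.Nonempty) (hB : ∀ x, ψ x ≤ B) :
    ∃ t, McalLim X ψ Z t = 0 := by
  obtain ⟨z, -⟩ := hZ
  have hcard : (0 : ℝ) < Fintype.card A := by
    have : Nonempty A := ⟨z.val 0⟩
    exact_mod_cast Fintype.card_pos
  set C := max B 0
  set L := Real.log (Fintype.card A)
  refine ⟨C + L + 1, McalLim_eq_zero_iff.2 fun N => ?_⟩
  have hbound : ∀ n : ℕ, N < n → Mcal X ψ Z (C + L + 1) N ≤ ENNReal.ofReal (Real.exp (-n)) := by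
    intro n hn
    let g : (Fin n → A) → List A := List.ofFn
    refine (Mcal_le (S := Set.range g) (Set.countable_range g) ?_ ?_).trans
      ((tsum_range_le g _).trans ?_)
    · rintro _ ⟨v, rfl⟩
      simpa [g] using hn
    · exact fun x _ => mem_iUnion₂.2 ⟨prefixWord x.val n, ⟨_, rfl⟩,
        mem_cylinder_prefixWord.2 fun _ _ => rfl⟩
    · have hterm : ∀ v : Fin n → A, cylWeight X ψ (C + L + 1) (g v) ≤
          ENNReal.ofReal (Real.exp (-(L + 1) * n)) := by
        intro v
        refine ENNReal.ofReal_le_ofReal (Real.exp_le_exp.2 ?_)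
        have hlen : (g v).length = n := by simp [g]
        rw [hlen]
        have : sSup (birkhoff (subShift X) ψ n '' (Subtype.val ⁻¹' cylinder (g v))) ≤ n * C := by
          refine Real.sSup_le ?_ (mul_nonneg (Nat.cast_nonneg _) (le_max_right _ _))
          rintro _ ⟨y, -, rfl⟩
          exact birkhoff_le _ (fun x => (hB x).trans (le_max_left _ _)) _ _
        linarith
      rw [tsum_fintype]
      refine (Finset.sum_le_sum fun v _ => hterm v).trans (le_of_eq ?_)
      rw [Finset.sum_const, nsmul_eq_mul, Finset.card_univ, Fintype.card_fun, Fintype.card_fin,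
        ← ENNReal.ofReal_natCast, ← ENNReal.ofReal_mul (Nat.cast_nonneg _)]
      congr 1
      have : ((Fintype.card A ^ n : ℕ) : ℝ) = Real.exp (L * n) := by
        rw [mul_comm, Real.exp_nat_mul, Real.exp_log hcard]
        push_cast
        rfl
      rw [this, ← Real.exp_add]
      congr 1
      ring
  have hlim : Tendsto (fun n : ℕ => ENNReal.ofReal (Real.exp (-n))) atTop (𝓝 0) := by
    rw [← ENNReal.ofReal_zero]
    exact ENNReal.tendsto_ofReal
      (Real.tendsto_exp_neg_atTop_nhds_zero.comp tendsto_natCast_atTop_atTop)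
  exact le_antisymm (ge_of_tendsto hlim ((eventually_gt_atTop N).mono hbound)) zero_le

theorem bddBelow_McalLim_eq_zero {b B : ℝ} (hZ : Z.Nonempty) (hb : ∀ x, b ≤ ψ x)
    (hB : ∀ x, ψ x ≤ B) : BddBelow {t | McalLim X ψ Z t = 0} :=
  ⟨b, fun _ ht => le_of_McalLim_eq_zero hZ hb hB ht⟩

theorem le_pressure {b B : ℝ} (hZ : Z.Nonempty) (hb : ∀ x, b ≤ ψ x) (hB : ∀ x, ψ x ≤ B) :
    b ≤ pressure X ψ Z :=
  le_csInf (exists_McalLim_eq_zero hZ hB) fun _ ht => le_of_McalLim_eq_zero hZ hb hB ht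

theorem pressure_le_add {b B B' c : ℝ} (hZ : Z.Nonempty) (hB : ∀ x, ψ x ≤ B)
    (hb : ∀ x, b ≤ χ x) (hB' : ∀ x, χ x ≤ B') (h : ∀ x, χ x ≤ ψ x + c) :
    pressure X χ Z ≤ pressure X ψ Z + c := by
  rw [← sub_le_iff_le_add]
  refine le_csInf (exists_McalLim_eq_zero hZ hB) fun t ht => ?_
  rw [sub_le_iff_le_add]
  exact csInf_le (bddBelow_McalLim_eq_zero hZ hb hB') (McalLim_eq_zero_of_le_add hB h ht)

theorem pressure_empty : pressure X ψ ∅ = 0 := by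
  have : {t | McalLim X ψ ∅ t = 0} = univ := by
    refine eq_univ_of_forall fun t => McalLim_eq_zero_iff.2 fun N => le_antisymm ?_ zero_le
    refine (Mcal_le (S := ∅) countable_empty (by simp) (by simp)).trans ?_
    simp
  rw [pressure, this, Real.sInf_univ]

end Caratheodory

section Hausdorff

variable {Y : Type*} {d : Y → Y → ℝ}

theorem ediam_le {U : Set Y} {c : ℝ≥0∞} (h : ∀ x ∈ U, ∀ y ∈ U, ENNReal.ofReal (d x y) ≤ c) :
    ediam d U ≤ c :=
  iSup₂_le fun x hx => iSup₂_le fun y hy => h x hx y hy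

theorem le_ediam {U : Set Y} {x y : Y} (hx : x ∈ U) (hy : y ∈ U) :
    ENNReal.ofReal (d x y) ≤ ediam d U :=
  (le_iSup₂ (f := fun y (_ : y ∈ U) => ENNReal.ofReal (d x y)) y hy).trans
    (le_iSup₂ (f := fun x (_ : x ∈ U) => ⨆ y ∈ U, ENNReal.ofReal (d x y)) x hx)

@[simp] theorem ediam_empty : ediam d ∅ = 0 := by simp [ediam]

theorem hMeasAux_le {s : ℝ} {ε : ℝ≥0∞} {Z : Set Y} {C : ℕ → Set Y} (hZ : Z ⊆ ⋃ n, C n)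
    (hC : ∀ n, ediam d (C n) ≤ ε) :
    hMeasAux d s ε Z ≤ ∑' n, ⨆ (_ : (C n).Nonempty), ediam d (C n) ^ s :=
  iInf_le_of_le C <| iInf_le_of_le hZ <| iInf_le_of_le hC le_rfl

theorem exists_of_hMeasAux_lt {s : ℝ} {ε c : ℝ≥0∞} {Z : Set Y} (h : hMeasAux d s ε Z < c) :
    ∃ C : ℕ → Set Y, Z ⊆ ⋃ n, C n ∧ (∀ n, ediam d (C n) ≤ ε) ∧
      ∑' n, ⨆ (_ : (C n).Nonempty), ediam d (C n) ^ s < c := by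
  by_contra! hc
  exact h.not_ge (le_iInf fun C => le_iInf fun h₁ => le_iInf fun h₂ => hc C h₁ h₂)

theorem hMeas_eq_zero_iff {s : ℝ} {Z : Set Y} :
    hMeas d s Z = 0 ↔ ∀ ε : ℝ≥0∞, 0 < ε → hMeasAux d s ε Z = 0 := by
  simp [hMeas]

theorem hdim_empty : hdim d (∅ : Set Y) = 0 := by
  have : {s : ℝ | 0 ≤ s ∧ hMeas d s ∅ = 0} = Ici 0 := by
    ext s
    refine and_iff_left (hMeas_eq_zero_iff.2 fun ε _ => le_antisymm ?_ zero_le)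
    refine (hMeasAux_le (C := fun _ => ∅) (by simp) (by simp)).trans ?_
    simp
  rw [hdim, this, csInf_Ici]

end Hausdorff

section Metric

variable {X : Set (ℕ → A)} {φ : ↥X → ℝ} {Z : Set ↥X} {m M s t : ℝ}

theorem dphi_of_ne {x y : ↥X} (h : x ≠ y) :
    dphi X φ x y = Real.exp (-(sSup (birkhoff (subShift X) φ (wedge x.val y.val) ''
      (Subtype.val ⁻¹' cylinder (prefixWord x.val (wedge x.val y.val)))))) := by
  rw [dphi, if_neg h]
  simp only [preimage, mem_cylinder_prefixWord]

theorem dphi_le (hM : ∀ x, φ x ≤ M) (hpos : ∀ x, 0 ≤ φ x) {x y : ↥X} {n : ℕ} {a : ℝ}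
    (h : ∀ i < n, x.val i = y.val i) (ha : a ≤ birkhoff (subShift X) φ n x) :
    dphi X φ x y ≤ Real.exp (-a) := by
  by_cases hxy : x = y
  · rw [dphi, if_pos hxy]
    positivity
  rw [dphi_of_ne hxy]
  refine Real.exp_le_exp.2 (neg_le_neg (ha.trans ?_))
  have hn : n ≤ wedge x.val y.val := by
    by_contra! hlt
    exact wedge_spec (Subtype.coe_ne_coe.2 hxy) (h _ hlt)
  exact (birkhoff_mono_length _ hpos hn x).trans (le_csSup (bddAbove_birkhoff _ hM _ _)
    (mem_image_of_mem _ (mem_cylinder_prefixWord.2 fun _ _ => rfl)))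

theorem ediam_cylinder_le (hm : ∀ x, m ≤ φ x) (hM : ∀ x, φ x ≤ M) (hm0 : 0 < m) (w : List A) :
    ediam (dphi X φ) (Subtype.val ⁻¹' cylinder w) ≤
      ENNReal.ofReal (Real.exp (-(w.length * m))) :=
  ediam_le fun _ hx _ hy => ENNReal.ofReal_le_ofReal <|
    dphi_le hM (fun z => hm0.le.trans (hm z)) (fun _ hi => eq_of_mem_cylinder hy hx hi)
      (le_birkhoff _ hm _ _)

theorem ediam_cylinder_rpow_le (hm : ∀ x, m ≤ φ x) (hM : ∀ x, φ x ≤ M) (hm0 : 0 < m)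
    (hs : 0 < s) (w : List A) :
    ediam (dphi X φ) (Subtype.val ⁻¹' cylinder w) ^ s ≤ cylWeight X (fun x => -s * φ x) 0 w := by
  set b := sSup (birkhoff (subShift X) (fun x => -s * φ x) w.length ''
    (Subtype.val ⁻¹' cylinder w)) with hb
  have hbdd : ∀ x, -s * φ x ≤ -s * m := fun x => by
    have := mul_le_mul_of_nonneg_left (hm x) hs.le
    linarith
  have hdiam : ediam (dphi X φ) (Subtype.val ⁻¹' cylinder w) ≤
      ENNReal.ofReal (Real.exp (b / s)) := by
    refine ediam_le fun x hx y hy => ENNReal.ofReal_le_ofReal ?_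
    rw [← neg_neg (b / s)]
    refine dphi_le hM (fun z => hm0.le.trans (hm z))
      (fun _ hi => eq_of_mem_cylinder hy hx hi) ?_
    have h1 := le_csSup (bddAbove_birkhoff (subShift X) hbdd w.length _)
      (mem_image_of_mem (birkhoff (subShift X) (fun x => -s * φ x) w.length) hx)
    rw [birkhoff_const_mul, ← hb] at h1
    rw [neg_le, div_eq_inv_mul, le_inv_mul_iff₀ hs]
    linarith
  refine (ENNReal.rpow_le_rpow hdiam hs.le).trans (le_of_eq ?_)
  rw [ENNReal.ofReal_rpow_of_pos (Real.exp_pos _), ← Real.exp_mul, div_mul_cancel₀ _ hs.ne',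
    cylWeight, neg_zero, zero_mul, zero_add]

theorem hMeas_eq_zero_of_McalLim (hm : ∀ x, m ≤ φ x) (hM : ∀ x, φ x ≤ M) (hm0 : 0 < m)
    (hs : 0 < s) (h : McalLim X (fun x => -s * φ x) Z 0 = 0) : hMeas (dphi X φ) s Z = 0 := by
  refine hMeas_eq_zero_iff.2 fun ε hε => le_antisymm (le_of_forall_gt fun η hη => ?_) zero_le
  obtain ⟨N, hN⟩ : ∃ N : ℕ, ENNReal.ofReal (Real.exp (-(N * m))) < ε := by
    have hlim : Tendsto (fun n : ℕ => ENNReal.ofReal (Real.exp (-(n * m)))) atTop (𝓝 0) := by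
      rw [← ENNReal.ofReal_zero]
      exact ENNReal.tendsto_ofReal (Real.tendsto_exp_neg_atTop_nhds_zero.comp
        (tendsto_natCast_atTop_atTop.atTop_mul_const hm0))
    exact (hlim.eventually_lt_const hε).exists
  obtain ⟨S, hS, hlen, hcov, hsum⟩ :=
    exists_of_Mcal_lt (((McalLim_eq_zero_iff.1 h) N).trans_lt hη)
  have : Countable S := hS.to_subtype
  have : Encodable S := Encodable.ofCountable S
  let f : S → Set ↥X := fun w => Subtype.val ⁻¹' cylinder (w : List A)
  refine (hMeasAux_le (C := fun n => ⋃ b ∈ Encodable.decode₂ S n, f b) ?_ ?_).trans_lt ?_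
  · rw [Encodable.iUnion_decode₂]
    simpa [f, iUnion_subtype] using hcov
  · intro n
    refine Encodable.iUnion_decode₂_cases (C := fun U => ediam (dphi X φ) U ≤ ε) (by simp)
      fun w : S => (ediam_cylinder_le hm hM hm0 w).trans (le_trans ?_ hN.le)
    have := hlen w w.2
    gcongr
  · rw [tsum_iUnion_decode₂ (fun U => ⨆ (_ : U.Nonempty), ediam (dphi X φ) U ^ s) (by simp) f]
    exact (ENNReal.tsum_le_tsum fun w : S =>
      iSup_le fun _ => ediam_cylinder_rpow_le hm hM hm0 hs w).trans_lt hsum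

/-- Uniform continuity of `φ` with respect to cylinders. -/
theorem exists_prefix_dist_le (hX : IsClosed X) (hφ : Continuous φ) {ε : ℝ} (hε : 0 < ε) :
    ∃ K : ℕ, ∀ x y : ↥X, (∀ i < K, x.val i = y.val i) → |φ x - φ y| ≤ ε := by
  let _ : MetricSpace (ℕ → A) := PiNat.metricSpace
  have : CompactSpace ↥X := isCompact_iff_compactSpace.1 hX.isCompact
  obtain ⟨δ, hδ, H⟩ := Metric.uniformContinuous_iff.1
    (CompactSpace.uniformContinuous_of_continuous hφ) ε hε
  obtain ⟨K, hK⟩ := exists_pow_lt_of_lt_one hδ (by norm_num : (1 / 2 : ℝ) < 1)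
  refine ⟨K, fun x y hxy => (H (lt_of_le_of_lt ?_ hK)).le⟩
  exact PiNat.mem_cylinder_iff_dist_le.1 hxy

/-- Birkhoff sums have sublinear variation on cylinders. -/
theorem exists_birkhoff_le_add (hX : IsClosed X) (hXinv : Set.MapsTo shift X X)
    (hφ : Continuous φ) (hpos : ∀ x, 0 ≤ φ x) (hM : ∀ x, φ x ≤ M) {ε : ℝ} (hε : 0 < ε) :
    ∃ V : ℝ, ∀ (n : ℕ) (x y : ↥X), (∀ i < n, x.val i = y.val i) →
      birkhoff (subShift X) φ n x ≤ birkhoff (subShift X) φ n y + (n * ε + V) := by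
  obtain ⟨K, hK⟩ := exists_prefix_dist_le hX hφ hε
  refine ⟨K * M, fun n x y hxy => ?_⟩
  have hM0 : 0 ≤ M := (hpos x).trans (hM x)
  have hterm : ∀ i ∈ Finset.range n, φ ((subShift X)^[i] x) ≤
      φ ((subShift X)^[i] y) + (ε + if n < i + K then M else 0) := by
    intro i hi
    split_ifs with hlt
    · linarith [hM ((subShift X)^[i] x), hpos ((subShift X)^[i] y)]
    · have := hK ((subShift X)^[i] x) ((subShift X)^[i] y) fun j hj => by
        rw [subShift_iterate_apply hXinv, subShift_iterate_apply hXinv]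
        exact hxy _ (by omega)
      linarith [(abs_le.1 this).2]
  refine (Finset.sum_le_sum hterm).trans ?_
  rw [Finset.sum_add_distrib, Finset.sum_add_distrib, ← Finset.sum_filter, Finset.sum_const,
    Finset.sum_const, nsmul_eq_mul, nsmul_eq_mul, Finset.card_range]
  have hcard : ((Finset.range n).filter fun i => n < i + K).card ≤ K := by
    calc _ ≤ (Finset.Ico (n - K) n).card := Finset.card_le_card fun i hi => by
          simp only [Finset.mem_filter, Finset.mem_range, Finset.mem_Ico] at hi ⊢
          omega
      _ ≤ K := by
        rw [Nat.card_Ico]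
        omega
  have : (((Finset.range n).filter fun i => n < i + K).card : ℝ) * M ≤ K * M := by gcongr
  change birkhoff (subShift X) φ n y + _ ≤ _
  linarith

/-- For `t > 0`, every set of small diameter is contained in a long cylinder of no larger weight,
up to an arbitrarily small error that accounts for sets with a single point. -/
theorem exists_cylinder_of_ediam_le (hX : IsClosed X) (hXinv : Set.MapsTo shift X X)
    (hφ : Continuous φ) (hφpos : ∀ x, 0 < φ x) (hM : ∀ x, φ x ≤ M) (hs : 0 ≤ s) (ht : 0 < t)
    (N : ℕ) : ∃ ε : ℝ≥0∞, 0 < ε ∧ ∀ C : Set ↥X, C.Nonempty → ediam (dphi X φ) C ≤ ε →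
      ∀ η : ℝ≥0∞, 0 < η → ∃ w : List A, N < w.length ∧ C ⊆ Subtype.val ⁻¹' cylinder w ∧
        cylWeight X (fun x => -s * φ x) t w ≤ ediam (dphi X φ) C ^ s + η := by
  obtain ⟨ε, hε, hεt⟩ : ∃ ε : ℝ, 0 < ε ∧ s * ε ≤ t / 2 := by
    refine ⟨t / 2 / (s + 1), by positivity, ?_⟩
    rw [mul_div_assoc', div_le_iff₀ (by positivity)]
    nlinarith
  obtain ⟨V, hV⟩ := exists_birkhoff_le_add hX hXinv hφ (fun x => (hφpos x).le) hM hε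
  obtain ⟨N₀, hN₀⟩ := exists_nat_ge (2 * s * V / t)
  set N₁ := max N₀ (N + 1)
  have hVt : ∀ n : ℕ, N₁ ≤ n → -t * n + s * (n * ε + V) ≤ 0 := by
    intro n hn
    have h1 : 2 * s * V / t ≤ n := hN₀.trans (by exact_mod_cast (le_max_left _ _).trans hn)
    rw [div_le_iff₀ ht] at h1
    have h2 := mul_le_mul_of_nonneg_left hεt (Nat.cast_nonneg (α := ℝ) n)
    linarith
  refine ⟨ENNReal.ofReal (Real.exp (-(N₁ * M))), by simp [Real.exp_pos], fun C hC hdiam η hη => ?_⟩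
  have hbdd : ∀ x, -s * φ x ≤ 0 := fun x => by
    have := mul_nonneg hs (hφpos x).le
    linarith
  rcases C.subsingleton_or_nontrivial with hsub | hnt
  · obtain ⟨x, hx⟩ := hC
    have hlim : Tendsto (fun n : ℕ => ENNReal.ofReal (Real.exp (-(n * t)))) atTop (𝓝 0) := by
      rw [← ENNReal.ofReal_zero]
      exact ENNReal.tendsto_ofReal (Real.tendsto_exp_neg_atTop_nhds_zero.comp
        (tendsto_natCast_atTop_atTop.atTop_mul_const ht))
    obtain ⟨n, hn, hnN⟩ :=
      ((hlim.eventually_lt_const hη).and (eventually_gt_atTop N)).exists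
    refine ⟨prefixWord x.val n, by simpa using hnN, fun y hy => ?_, ?_⟩
    · rw [hsub hy hx]
      exact mem_cylinder_prefixWord.2 fun _ _ => rfl
    · refine le_trans ?_ (hn.le.trans le_add_self)
      refine ENNReal.ofReal_le_ofReal (Real.exp_le_exp.2 ?_)
      rw [length_prefixWord]
      have : sSup (birkhoff (subShift X) (fun x => -s * φ x) n ''
          (Subtype.val ⁻¹' cylinder (prefixWord x.val n))) ≤ 0 := by
        refine Real.sSup_le ?_ le_rfl
        rintro _ ⟨y, -, rfl⟩
        simpa using birkhoff_le (subShift X) hbdd n y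
      linarith
  · have hex : ∃ k : ℕ, ∃ x ∈ C, ∃ y ∈ C, x ≠ y ∧ wedge x.val y.val = k := by
      obtain ⟨x, hx, y, hy, hxy⟩ := hnt
      exact ⟨_, x, hx, y, hy, hxy, rfl⟩
    obtain ⟨x, hx, y, hy, hxy, hk⟩ := Nat.find_spec hex
    set k := Nat.find hex
    have hmin : ∀ z ∈ C, ∀ i < k, z.val i = x.val i := by
      intro z hz i hi
      by_cases hxz : x = z
      · rw [hxz]
      · exact (eq_of_lt_wedge (hi.trans_le (Nat.find_min' hex ⟨x, hx, z, hz, hxz, rfl⟩))).symm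
    set w := prefixWord x.val k with hw
    have hxw : x ∈ (Subtype.val ⁻¹' cylinder w : Set ↥X) :=
      mem_cylinder_prefixWord.2 fun _ _ => rfl
    set b := sSup (birkhoff (subShift X) φ k '' (Subtype.val ⁻¹' cylinder w)) with hb
    have hd : dphi X φ x y = Real.exp (-b) := by rw [dphi_of_ne hxy, hk]
    have hle : ENNReal.ofReal (Real.exp (-b)) ≤ ediam (dphi X φ) C := by
      rw [← hd]
      exact le_ediam hx hy
    have hbM : b ≤ k * M := by
      refine csSup_le ⟨_, mem_image_of_mem _ hxw⟩ ?_
      rintro _ ⟨z, -, rfl⟩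
      exact birkhoff_le _ hM _ _
    have hkN : N₁ ≤ k := by
      by_contra! hlt
      have hM0 : 0 < M := (hφpos x).trans_le (hM x)
      have h1 := (ENNReal.ofReal_le_ofReal_iff (Real.exp_pos _).le).1 (hle.trans hdiam)
      rw [Real.exp_le_exp] at h1
      have h2 : (k : ℝ) * M < N₁ * M := by gcongr
      linarith
    refine ⟨w, ?_, fun z hz => mem_cylinder_prefixWord.2 (hmin z hz), ?_⟩
    · rw [hw, length_prefixWord]
      exact (Nat.lt_succ_self N).trans_le ((le_max_right _ _).trans hkN)
    · refine le_trans ?_ (le_add_right (ENNReal.rpow_le_rpow hle hs))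
      rw [ENNReal.ofReal_rpow_of_pos (Real.exp_pos _), ← Real.exp_mul]
      refine ENNReal.ofReal_le_ofReal (Real.exp_le_exp.2 ?_)
      rw [hw, length_prefixWord, ← hw]
      have : sSup (birkhoff (subShift X) (fun x => -s * φ x) k '' (Subtype.val ⁻¹' cylinder w)) ≤
          -b * s + s * (k * ε + V) := by
        refine csSup_le ⟨_, mem_image_of_mem _ hxw⟩ ?_
        rintro _ ⟨z, hz, rfl⟩
        rw [birkhoff_const_mul]
        have hbz : b ≤ birkhoff (subShift X) φ k z + (k * ε + V) := by
          refine csSup_le ⟨_, mem_image_of_mem _ hxw⟩ ?_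
          rintro _ ⟨z', hz', rfl⟩
          exact hV k z' z fun i hi => eq_of_mem_cylinder hz hz' (by simpa [hw] using hi)
        have := mul_le_mul_of_nonneg_left hbz hs
        linarith
      linarith [hVt k hkN]

theorem McalLim_eq_zero_of_hMeas (hX : IsClosed X) (hXinv : Set.MapsTo shift X X)
    (hφ : Continuous φ) (hφpos : ∀ x, 0 < φ x) (hM : ∀ x, φ x ≤ M) (hs : 0 ≤ s) (ht : 0 < t)
    (h : hMeas (dphi X φ) s Z = 0) : McalLim X (fun x => -s * φ x) Z t = 0 := by
  refine McalLim_eq_zero_iff.2 fun N =>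
    le_antisymm (ENNReal.le_of_forall_pos_le_add fun η hη _ => ?_) zero_le
  obtain ⟨ε, hε, H⟩ := exists_cylinder_of_ediam_le hX hXinv hφ hφpos hM hs ht N
  have hη2 : (η : ℝ≥0∞) / 2 ≠ 0 := by simpa using hη.ne'
  obtain ⟨C, hcov, hdiam, hsum⟩ := exists_of_hMeasAux_lt
    ((hMeas_eq_zero_iff.1 h ε hε).trans_lt (pos_iff_ne_zero.2 hη2))
  obtain ⟨δ, hδ, hδsum⟩ := ENNReal.exists_pos_sum_of_countable' hη2 {n : ℕ // (C n).Nonempty}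
  choose g hg₁ hg₂ hg₃ using fun n : {n : ℕ // (C n).Nonempty} =>
    H (C n) n.2 (hdiam n) (δ n) (hδ n)
  refine (Mcal_le (S := Set.range g) (Set.countable_range g) ?_ ?_).trans
    ((tsum_range_le g _).trans ?_)
  · rintro _ ⟨n, rfl⟩
    exact hg₁ n
  · intro z hz
    obtain ⟨n, hn⟩ := mem_iUnion.1 (hcov hz)
    exact mem_iUnion₂.2 ⟨_, ⟨⟨n, z, hn⟩, rfl⟩, hg₂ ⟨n, z, hn⟩ hn⟩
  · refine (ENNReal.tsum_le_tsum hg₃).trans ?_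
    rw [ENNReal.tsum_add, zero_add, ← ENNReal.add_halves (η : ℝ≥0∞)]
    refine add_le_add (le_trans ?_ hsum.le) hδsum.le
    refine le_trans (ENNReal.tsum_le_tsum fun n => ?_)
      (ENNReal.tsum_comp_le_tsum_of_injective Subtype.val_injective
        fun n => ⨆ (_ : (C n).Nonempty), ediam (dphi X φ) (C n) ^ s)
    exact le_iSup_of_le n.2 le_rfl

end Metric

/-- Bowen's equation for the Hausdorff dimension w.r.t. `d_φ`. -/
theorem statement_18 {A : Type} [Fintype A] [DecidableEq A] [TopologicalSpace A]
    [DiscreteTopology A] [MeasurableSpace A] [BorelSpace A]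
    (X : Set (ℕ → A)) (hXcl : IsClosed X) (hXinv : Set.MapsTo shift X X)
    (φ : ↥X → ℝ) (hφ : Continuous φ) (hφpos : ∀ x, 0 < φ x) (Z : Set ↥X) :
    hdim (dphi X φ) Z = sInf {s : ℝ | pressure X (fun x => -s * φ x) Z ≤ 0} ∧
      pressure X (fun x => -(hdim (dphi X φ) Z) * φ x) Z = 0 := by
  rcases Z.eq_empty_or_nonempty with rfl | hZ
  · simp [pressure_empty, hdim_empty]
  have : CompactSpace ↥X := isCompact_iff_compactSpace.1 hXcl.isCompact
  have : Nonempty ↥X := hZ.to_type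
  obtain ⟨xm, hxm⟩ := (isCompact_univ (X := ↥X)).exists_isMinOn univ_nonempty hφ.continuousOn
  obtain ⟨xM, hxM⟩ := (isCompact_univ (X := ↥X)).exists_isMaxOn univ_nonempty hφ.continuousOn
  set m := φ xm
  set M := φ xM
  have hm : ∀ x, m ≤ φ x := fun x => hxm.2 (mem_univ x)
  have hM : ∀ x, φ x ≤ M := fun x => hxM.2 (mem_univ x)
  have hm0 : 0 < m := hφpos xm
  have habs : ∀ s x, |-s * φ x| ≤ |s| * M := fun s x => by
    rw [abs_mul, abs_neg, abs_of_pos (hφpos x)]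
    gcongr
    exact hM x
  have hlow : ∀ s x, -(|s| * M) ≤ -s * φ x := fun s x => (abs_le.1 (habs s x)).1
  have hupp : ∀ s x, -s * φ x ≤ |s| * M := fun s x => (abs_le.1 (habs s x)).2
  set P : ℝ → ℝ := fun s => pressure X (fun x => -s * φ x) Z with hP
  have hdecr : ∀ s s', s ≤ s' → P s' ≤ P s + -((s' - s) * m) := fun s s' hss =>
    pressure_le_add hZ (hupp s) (hlow s') (hupp s') fun x => by
      have := mul_le_mul_of_nonneg_left (hm x) (sub_nonneg.2 hss)
      linarith
  have hincr : ∀ s s', s ≤ s' → P s ≤ P s' + (s' - s) * M := fun s s' hss =>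
    pressure_le_add hZ (hupp s') (hlow s) (hupp s) fun x => by
      have := mul_le_mul_of_nonneg_left (hM x) (sub_nonneg.2 hss)
      linarith
  have hanti : StrictAnti P := fun s s' hss => by
    have := mul_pos (sub_pos.2 hss) hm0
    linarith [hdecr s s' hss.le]
  have hcont : Continuous P := by
    refine (LipschitzWith.of_le_add_mul (Real.toNNReal M) fun s s' => ?_).continuous
    rw [Real.coe_toNNReal _ (hφpos xM).le, Real.dist_eq]
    rcases le_total s s' with hss | hss
    · rw [abs_sub_comm, abs_of_nonneg (sub_nonneg.2 hss), mul_comm]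
      exact hincr s s' hss
    · have := mul_nonneg (hφpos xM).le (abs_nonneg (s - s'))
      linarith [hanti.antitone hss]
  have hP0 : 0 ≤ P 0 := le_pressure hZ (b := 0) (by simp) (hupp 0)
  obtain ⟨s₀, hs₀, hPs₀⟩ : ∃ s₀, 0 ≤ s₀ ∧ P s₀ = 0 := by
    have hs₁ : 0 ≤ P 0 / m := by positivity
    have hPs₁ : P (P 0 / m) ≤ 0 := by
      have := hdecr 0 _ hs₁
      rw [sub_zero, div_mul_cancel₀ _ hm0.ne'] at this
      linarith
    obtain ⟨s₀, h, h'⟩ := intermediate_value_Icc' hs₁ hcont.continuousOn ⟨hPs₁, hP0⟩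
    exact ⟨s₀, h.1, h'⟩
  have hset : {s : ℝ | P s ≤ 0} = Ici s₀ := by
    ext s
    rw [mem_ofPred_eq, ← hPs₀, hanti.le_iff_ge, mem_Ici]
  have hdim_eq : hdim (dphi X φ) Z = s₀ := by
    have hmem : ∀ s, s₀ < s → s ∈ {s : ℝ | 0 ≤ s ∧ hMeas (dphi X φ) s Z = 0} := by
      intro s hs
      have hPs : P s < 0 := hPs₀ ▸ hanti hs
      obtain ⟨t, ht, ht0⟩ := exists_lt_of_csInf_lt (exists_McalLim_eq_zero hZ (hupp s)) hPs
      refine ⟨hs₀.trans hs.le, hMeas_eq_zero_of_McalLim hm hM hm0 (hs₀.trans_lt hs) ?_⟩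
      have := McalLim_eq_zero_of_le_add (χ := fun x => -s * φ x) (c := -t) (hupp s)
        (fun x => by linarith) ht
      rwa [add_neg_cancel] at this
    refine csInf_eq_of_forall_ge_of_forall_gt_exists_lt ⟨s₀ + 1, hmem _ (lt_add_one s₀)⟩ ?_ ?_
    · rintro s ⟨hs, hs'⟩
      have hPs : P s ≤ 0 := le_of_forall_gt_imp_ge_of_dense fun t ht =>
        csInf_le (bddBelow_McalLim_eq_zero hZ (hlow s) (hupp s))
          (McalLim_eq_zero_of_hMeas hXcl hXinv hφ hφpos hM hs ht hs')
      rwa [← hPs₀, hanti.le_iff_ge] at hPs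
    · intro b hb
      obtain ⟨s, hs, hsb⟩ := exists_between hb
      exact ⟨s, hmem s hs, hsb⟩
  rw [hdim_eq]
  exact ⟨by rw [hset, csInf_Ici], hPs₀⟩

end Paper
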